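/- arXiv:2511.14115 — 4 statements merged into one kernel-verified Lean document; each statement's English description precedes it below -/
import Mathlib

section
/- Let N ≥ 1, let α1, α2 > 0 and let τ be a constant with 0 < τ ≤ min(α1, α2). Then there exists a constant C > 0 such that for all points a, b, y ∈ ℝ^N with a ≠ b: (1+|y−a|)^{−α1} (1+|y−b|)^{−α2} ≤ C |a−b|^{−τ} [ (1+|y−a|)^{−(α1+α2−τ)} + (1+|y−b|)^{−(α1+α2−τ)} ]. -/
noncomputable section

theorem wie_aux (A B d p q t : ℝ) (hA : 0 < A) (hAB : A ≤ B) (hd : 0 < d) (hdB : d ≤ 2 * B)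
    (ht : 0 < t) (htq : t ≤ q) :
    A ^ (-p) * B ^ (-q) ≤ 2 ^ t * d ^ (-t) * A ^ (-(p + q - t)) := by
  have hB : 0 < B := lt_of_lt_of_le hA hAB
  have e1 : B ^ (-q) = B ^ (-(q - t)) * B ^ (-t) := by
    rw [← Real.rpow_add hB]; congr 1; ring
  have e2 : A ^ (-(p + q - t)) = A ^ (-p) * A ^ (-(q - t)) := by
    rw [← Real.rpow_add hA]; congr 1; ring
  have h1 : B ^ (-(q - t)) ≤ A ^ (-(q - t)) :=
    Real.rpow_le_rpow_of_nonpos hA hAB (by linarith)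
  have h2 : B ^ (-t) ≤ 2 ^ t * d ^ (-t) := by
    have h3 : (2 * B) ^ (-t) ≤ d ^ (-t) := Real.rpow_le_rpow_of_nonpos hd hdB (by linarith)
    rw [Real.mul_rpow (by norm_num) hB.le] at h3
    have h4 : (2 : ℝ) ^ t * 2 ^ (-t) = 1 := by
      rw [← Real.rpow_add (by norm_num)]; simp
    calc B ^ (-t) = 2 ^ t * (2 ^ (-t) * B ^ (-t)) := by rw [← mul_assoc, h4, one_mul]
      _ ≤ _ := by gcongr
  rw [e1, e2]
  calc A ^ (-p) * (B ^ (-(q - t)) * B ^ (-t))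
      ≤ A ^ (-p) * (A ^ (-(q - t)) * (2 ^ t * d ^ (-t))) := by gcongr
    _ = _ := by ring

/-- Lemma A.1: basic interaction estimate between two translated decaying weights. -/
theorem weight_interaction_estimate
    (N : ℕ) (hN : 1 ≤ N)
    (α1 α2 τ : ℝ) (hα1 : 0 < α1) (hα2 : 0 < α2)
    (hτ0 : 0 < τ) (hτ : τ ≤ min α1 α2) :
    ∃ C : ℝ, 0 < C ∧
      ∀ a b y : EuclideanSpace ℝ (Fin N), a ≠ b →
        (1 + ‖y - a‖) ^ (-α1) * (1 + ‖y - b‖) ^ (-α2) ≤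
          C * ‖a - b‖ ^ (-τ) *
            ((1 + ‖y - a‖) ^ (-(α1 + α2 - τ)) + (1 + ‖y - b‖) ^ (-(α1 + α2 - τ))) := by
  refine ⟨2 ^ τ, by positivity, fun a b y hab => ?_⟩
  have hd : 0 < ‖a - b‖ := norm_pos_iff.mpr (sub_ne_zero.mpr hab)
  have htri : ‖a - b‖ ≤ ‖y - a‖ + ‖y - b‖ := by
    have h := norm_sub_le (y - b) (y - a)
    have e : y - b - (y - a) = a - b := by abel
    rw [e] at h
    linarith
  have hA : 0 < 1 + ‖y - a‖ := by positivity
  have hB : 0 < 1 + ‖y - b‖ := by positivity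
  have ht1 := hτ.trans (min_le_left _ _)
  have ht2 := hτ.trans (min_le_right _ _)
  have hC : 0 ≤ 2 ^ τ * ‖a - b‖ ^ (-τ) := by positivity
  rcases le_total (1 + ‖y - a‖) (1 + ‖y - b‖) with h | h
  · refine (wie_aux _ _ ‖a - b‖ α1 α2 τ hA h hd (by linarith) hτ0 ht2).trans ?_
    exact mul_le_mul_of_nonneg_left (le_add_of_nonneg_right (by positivity)) hC
  · rw [mul_comm]
    refine (wie_aux _ _ ‖a - b‖ α2 α1 τ hB h hd (by linarith) hτ0 ht1).trans ?_
    rw [add_comm α2 α1]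
    exact mul_le_mul_of_nonneg_left (le_add_of_nonneg_left (by positivity)) hC
end
end

section
/- Let N ≥ 3 and let σ > 0 with σ ≠ N−2. Then there exists a constant C > 0 such that for every y ∈ ℝ^N: ∫_{ℝ^N} |y−z|^{−(N−2)} (1+|z|)^{−(2+σ)} dz ≤ C (1+|y|)^{−min(σ, N−2)}. -/
open MeasureTheory

noncomputable section

lemma aux_rad (N : ℕ) (hN : 3 ≤ N) (s r : ℝ) (hr : 0 < r) (hs : s < N) :
    Integrable ((Metric.ball (0 : EuclideanSpace ℝ (Fin N)) r).indicator
      (fun x => ‖x‖ ^ (-s))) := by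
  haveI : Nonempty (Fin N) := ⟨⟨0, by omega⟩⟩
  rw [integrable_indicator_iff measurableSet_ball]
  rw [integrableOn_fun_norm_addHaar volume (f := fun t : ℝ => t ^ (-s))]
  have h := (intervalIntegral.integrableOn_Ioo_rpow_iff (s := (N : ℝ) - 1 - s) hr).2 (by linarith)
  refine h.congr_fun ?_ measurableSet_Ioo
  intro t ht
  have h0 : 0 < t := ht.1
  simp only [finrank_euclideanSpace, Fintype.card_fin, smul_eq_mul]
  rw [← Real.rpow_natCast, ← Real.rpow_add h0]
  congr 1
  rw [Nat.cast_sub (by omega)]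
  push_cast
  ring

lemma aux_F2 (N : ℕ) (hN : 3 ≤ N) (σ : ℝ) (hσ : 0 < σ) (h : σ < (N : ℝ) - 2) :
    Integrable (fun w : EuclideanSpace ℝ (Fin N) =>
      (1 + ‖w‖) ^ (-((N : ℝ) - 2)) * ‖w‖ ^ (-(2 + σ))) := by
  have h1 := aux_rad N hN (2 + σ) 1 one_pos (by linarith)
  have h2 : Integrable (fun w : EuclideanSpace ℝ (Fin N) => (1 + ‖w‖) ^ (-((N : ℝ) + σ))) :=
    integrable_one_add_norm (by simp [hσ])
  refine (h1.add (h2.const_mul ((2 : ℝ) ^ (2 + σ)))).mono'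
    (Measurable.aestronglyMeasurable (by fun_prop)) ?_
  refine Filter.Eventually.of_forall fun w => ?_
  have hw := norm_nonneg w
  rw [Real.norm_of_nonneg (by positivity)]
  simp only [Pi.add_apply]
  by_cases hb : w ∈ Metric.ball (0 : EuclideanSpace ℝ (Fin N)) 1
  · rw [Set.indicator_of_mem hb]
    have : (1 + ‖w‖) ^ (-((N : ℝ) - 2)) ≤ 1 :=
      Real.rpow_le_one_of_one_le_of_nonpos (by linarith) (by linarith)
    have h3 : 0 ≤ ‖w‖ ^ (-(2 + σ)) := by positivity
    have h4 : 0 ≤ (2 : ℝ) ^ (2 + σ) * (1 + ‖w‖) ^ (-((N : ℝ) + σ)) := by positivity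
    nlinarith
  · rw [Set.indicator_of_notMem hb, zero_add]
    simp only [Metric.mem_ball, dist_zero_right, not_lt] at hb
    have h3 : ‖w‖ ^ (-(2 + σ)) ≤ ((1 + ‖w‖) / 2) ^ (-(2 + σ)) :=
      Real.rpow_le_rpow_of_nonpos (by positivity) (by linarith) (by linarith)
    have h4 : ((1 + ‖w‖) / 2) ^ (-(2 + σ)) = (2 : ℝ) ^ (2 + σ) * (1 + ‖w‖) ^ (-(2 + σ)) := by
      rw [Real.div_rpow (by positivity) (by positivity), Real.rpow_neg (by norm_num : (0:ℝ) ≤ 2)]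
      field_simp
    have h5 : (1 + ‖w‖) ^ (-((N : ℝ) + σ)) =
        (1 + ‖w‖) ^ (-((N : ℝ) - 2)) * (1 + ‖w‖) ^ (-(2 + σ)) := by
      rw [← Real.rpow_add (by positivity)]; congr 1; ring
    rw [h5]
    calc _ ≤ (1 + ‖w‖) ^ (-((N : ℝ) - 2)) * ((2 : ℝ) ^ (2 + σ) * (1 + ‖w‖) ^ (-(2 + σ))) := by
          rw [← h4]; gcongr
      _ = _ := by ring

lemma aux_B (N : ℕ) (hN : 3 ≤ N) (σ : ℝ) (hσ : 0 < σ) (hσ' : σ ≠ (N : ℝ) - 2) :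
    ∃ K : ℝ, 0 ≤ K ∧ ∀ R : ℝ, 1 ≤ R → ∃ G : EuclideanSpace ℝ (Fin N) → ℝ,
      Integrable G ∧ (∀ z, 0 ≤ G z) ∧ (∫ z, G z) ≤ K * R ^ (-(min σ ((N : ℝ) - 2))) ∧
      ∀ᵐ z, ∀ d : ℝ, R ≤ 2 * d → ‖z‖ ≤ 3 * d →
        d ^ (-((N : ℝ) - 2)) * (1 + ‖z‖) ^ (-(2 + σ)) ≤ G z := by
  have hN' : (3 : ℝ) ≤ N := by exact_mod_cast hN
  haveI : Nonempty (Fin N) := ⟨⟨0, by omega⟩⟩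
  rcases lt_or_gt_of_ne hσ' with h | h
  · have hF := aux_F2 N hN σ hσ h
    set F : EuclideanSpace ℝ (Fin N) → ℝ := fun w =>
      (1 + ‖w‖) ^ (-((N : ℝ) - 2)) * ‖w‖ ^ (-(2 + σ)) with hFd
    have hF0 : ∀ w, 0 ≤ F w := fun w => by simp only [hFd]; positivity
    refine ⟨(5 : ℝ) ^ ((N : ℝ) - 2) * ∫ w, F w,
      mul_nonneg (by positivity) (integral_nonneg hF0), fun R hR => ?_⟩
    have hR0 : 0 < R := by linarith
    refine ⟨fun z => (5 : ℝ) ^ ((N : ℝ) - 2) * R ^ (-((N : ℝ) + σ)) * F (R⁻¹ • z),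
      (hF.comp_smul (inv_ne_zero hR0.ne')).const_mul _,
      fun z => mul_nonneg (by positivity) (hF0 _), ?_, ?_⟩
    · rw [integral_const_mul, Measure.integral_comp_inv_smul_of_nonneg _ _ hR0.le]
      simp only [finrank_euclideanSpace, Fintype.card_fin, smul_eq_mul]
      rw [min_eq_left h.le]
      apply le_of_eq
      have : R ^ (-σ) = R ^ (-((N : ℝ) + σ)) * R ^ N := by
        rw [← Real.rpow_natCast, ← Real.rpow_add hR0]; congr 1; ring
      rw [this]; ring
    · have hne : ∀ᵐ z : EuclideanSpace ℝ (Fin N), z ≠ 0 := by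
        simp [ae_iff]
      filter_upwards [hne] with z hz d hd hzd
      have hz0 : 0 < ‖z‖ := norm_pos_iff.2 hz
      have hd0 : 0 < d := by linarith
      have e1 : F (R⁻¹ • z) = R ^ ((N : ℝ) + σ) *
          ((R + ‖z‖) ^ (-((N : ℝ) - 2)) * ‖z‖ ^ (-(2 + σ))) := by
        simp only [hFd, norm_smul, norm_inv, Real.norm_of_nonneg hR0.le]
        have : 1 + R⁻¹ * ‖z‖ = R⁻¹ * (R + ‖z‖) := by field_simp
        rw [this, Real.mul_rpow (by positivity) (by positivity),
          Real.mul_rpow (by positivity) (by positivity), Real.inv_rpow hR0.le,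
          Real.inv_rpow hR0.le, ← Real.rpow_neg hR0.le, ← Real.rpow_neg hR0.le]
        have : R ^ ((N : ℝ) + σ) = R ^ (- -((N : ℝ) - 2)) * R ^ (- -(2 + σ)) := by
          rw [← Real.rpow_add hR0]; congr 1; ring
        rw [this]; ring
      have e2 : R ^ (-((N : ℝ) + σ)) * R ^ ((N : ℝ) + σ) = 1 := by
        rw [← Real.rpow_add hR0]; simp
      have e3 : (5 : ℝ) ^ ((N : ℝ) - 2) * R ^ (-((N : ℝ) + σ)) * F (R⁻¹ • z) =
          ((5 : ℝ) ^ ((N : ℝ) - 2) * (R + ‖z‖) ^ (-((N : ℝ) - 2))) * ‖z‖ ^ (-(2 + σ)) := by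
        rw [e1]
        linear_combination ((5 : ℝ) ^ ((N : ℝ) - 2) * (R + ‖z‖) ^ (-((N : ℝ) - 2))
          * ‖z‖ ^ (-(2 + σ))) * e2
      rw [e3]
      have e4 : (5 : ℝ) ^ ((N : ℝ) - 2) * (R + ‖z‖) ^ (-((N : ℝ) - 2)) =
          ((R + ‖z‖) / 5) ^ (-((N : ℝ) - 2)) := by
        rw [Real.div_rpow (by positivity) (by positivity),
          Real.rpow_neg (by norm_num : (0:ℝ) ≤ 5)]
        field_simp
      rw [e4]
      apply mul_le_mul
      · exact Real.rpow_le_rpow_of_nonpos (by positivity) (by linarith) (by linarith)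
      · exact Real.rpow_le_rpow_of_nonpos (by positivity) (by linarith) (by linarith)
      · positivity
      · positivity
  · have hF : Integrable (fun w : EuclideanSpace ℝ (Fin N) => (1 + ‖w‖) ^ (-(2 + σ))) :=
      integrable_one_add_norm (by simp; linarith)
    refine ⟨(2 : ℝ) ^ ((N : ℝ) - 2) *
      ∫ w : EuclideanSpace ℝ (Fin N), (1 + ‖w‖) ^ (-(2 + σ)),
      mul_nonneg (by positivity) (integral_nonneg fun w => by positivity), fun R hR => ?_⟩
    have hR0 : 0 < R := by linarith
    refine ⟨fun z => (2 : ℝ) ^ ((N : ℝ) - 2) * R ^ (-((N : ℝ) - 2)) * (1 + ‖z‖) ^ (-(2 + σ)),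
      hF.const_mul _, fun z => by positivity, ?_, ?_⟩
    · rw [integral_const_mul, min_eq_right h.le]
      apply le_of_eq; ring
    · refine Filter.Eventually.of_forall fun z d hd _ => ?_
      have e4 : (2 : ℝ) ^ ((N : ℝ) - 2) * R ^ (-((N : ℝ) - 2)) =
          (R / 2) ^ (-((N : ℝ) - 2)) := by
        rw [Real.div_rpow (by positivity) (by positivity),
          Real.rpow_neg (by norm_num : (0:ℝ) ≤ 2)]
        field_simp
      rw [e4]
      apply mul_le_mul_of_nonneg_right _ (by positivity)
      exact Real.rpow_le_rpow_of_nonpos (by positivity) (by linarith) (by linarith)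

/-- Lemma A.2: decay of the Newtonian-potential-type convolution of a polynomially
decaying weight. -/
theorem newtonian_convolution_decay
    (N : ℕ) (hN : 3 ≤ N)
    (σ : ℝ) (hσ : 0 < σ) (hσ' : σ ≠ (N : ℝ) - 2) :
    ∃ C : ℝ, 0 < C ∧
      ∀ y : EuclideanSpace ℝ (Fin N),
        (∫ z : EuclideanSpace ℝ (Fin N),
            ‖y - z‖ ^ (-((N : ℝ) - 2)) * (1 + ‖z‖) ^ (-(2 + σ))) ≤
          C * (1 + ‖y‖) ^ (-(min σ ((N : ℝ) - 2))) := by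
  have hN' : (3 : ℝ) ≤ N := by exact_mod_cast hN
  obtain ⟨K, hK, hB⟩ := aux_B N hN σ hσ hσ'
  have hF := aux_rad N hN ((N : ℝ) - 2) (1 / 2) (by norm_num) (by linarith)
  set F := (Metric.ball (0 : EuclideanSpace ℝ (Fin N)) (1 / 2)).indicator
      (fun x => ‖x‖ ^ (-((N : ℝ) - 2))) with hFd
  have hF0 : ∀ w, 0 ≤ F w := fun w => Set.indicator_nonneg (fun x _ => by positivity) w
  have hI : 0 ≤ ∫ w, F w := integral_nonneg hF0
  refine ⟨(2 : ℝ) ^ (2 + σ) * (∫ w, F w) + K + 1, by positivity, fun y => ?_⟩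
  have hy := norm_nonneg y
  set R := 1 + ‖y‖ with hRd
  have hR : 1 ≤ R := by linarith
  have hR0 : 0 < R := by linarith
  obtain ⟨G, hG, hG0, hGI, hGz⟩ := hB R hR
  set c : ℝ := (2 : ℝ) ^ (2 + σ) * R ^ (-((N : ℝ) + σ)) with hc
  have hc0 : 0 ≤ c := by positivity
  have hA : Integrable (fun z => c * F (R⁻¹ • (y - z))) :=
    ((hF.comp_smul (inv_ne_zero hR0.ne')).comp_sub_left y).const_mul c
  have hAI : (∫ z, c * F (R⁻¹ • (y - z))) = (2 : ℝ) ^ (2 + σ) * (∫ w, F w) * R ^ (-σ) := by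
    rw [integral_const_mul, integral_sub_left_eq_self (fun z => F (R⁻¹ • z)) volume y,
      Measure.integral_comp_inv_smul_of_nonneg _ _ hR0.le]
    simp only [finrank_euclideanSpace, Fintype.card_fin, smul_eq_mul]
    have : R ^ (-σ) = R ^ (-((N : ℝ) + σ)) * R ^ N := by
      rw [← Real.rpow_natCast, ← Real.rpow_add hR0]; congr 1; ring
    rw [this, hc]; ring
  have hmain : (∫ z : EuclideanSpace ℝ (Fin N),
      ‖y - z‖ ^ (-((N : ℝ) - 2)) * (1 + ‖z‖) ^ (-(2 + σ))) ≤
      ∫ z, (c * F (R⁻¹ • (y - z)) + G z) := by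
    apply integral_mono_of_nonneg
    · exact Filter.Eventually.of_forall fun z => by positivity
    · exact hA.add hG
    · filter_upwards [hGz] with z hz
      have htri : ‖y‖ ≤ ‖y - z‖ + ‖z‖ := by simpa using norm_add_le (y - z) z
      have htri2 : ‖z‖ ≤ ‖y - z‖ + ‖y‖ := by
        have := norm_sub_le y (y - z)
        rw [sub_sub_cancel] at this; linarith
      by_cases hd : R ≤ 2 * ‖y - z‖
      · have h1 := hz ‖y - z‖ hd (by linarith)
        have h2 := mul_nonneg hc0 (hF0 (R⁻¹ • (y - z)))
        linarith
      · push Not at hd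
        have hmem : R⁻¹ • (y - z) ∈ Metric.ball (0 : EuclideanSpace ℝ (Fin N)) (1 / 2) := by
          rw [mem_ball_zero_iff, norm_smul, norm_inv, Real.norm_of_nonneg hR0.le,
            inv_mul_lt_iff₀ hR0]
          linarith
        have e1 : F (R⁻¹ • (y - z)) = R ^ ((N : ℝ) - 2) * ‖y - z‖ ^ (-((N : ℝ) - 2)) := by
          rw [hFd, Set.indicator_of_mem hmem, norm_smul, norm_inv, Real.norm_of_nonneg hR0.le,
            Real.mul_rpow (by positivity) (by positivity), Real.inv_rpow hR0.le,
            ← Real.rpow_neg hR0.le, neg_neg]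
        have e2 : R ^ (-((N : ℝ) + σ)) * R ^ ((N : ℝ) - 2) = R ^ (-(2 + σ)) := by
          rw [← Real.rpow_add hR0]; congr 1; ring
        have e4 : (2 : ℝ) ^ (2 + σ) * R ^ (-(2 + σ)) = (R / 2) ^ (-(2 + σ)) := by
          rw [Real.div_rpow (by positivity) (by positivity),
            Real.rpow_neg (by norm_num : (0:ℝ) ≤ 2)]
          field_simp
        have e5 : c * F (R⁻¹ • (y - z)) = ‖y - z‖ ^ (-((N : ℝ) - 2)) * (R / 2) ^ (-(2 + σ)) := by
          rw [e1, ← e4, ← e2, hc]; ring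
        have e6 : (1 + ‖z‖) ^ (-(2 + σ)) ≤ (R / 2) ^ (-(2 + σ)) :=
          Real.rpow_le_rpow_of_nonpos (by positivity) (by linarith) (by linarith)
        have e7 := mul_le_mul_of_nonneg_left e6
          (by positivity : 0 ≤ ‖y - z‖ ^ (-((N : ℝ) - 2)))
        have := hG0 z
        linarith
  rw [integral_add hA hG, hAI] at hmain
  have hle : R ^ (-σ) ≤ R ^ (-(min σ ((N : ℝ) - 2))) :=
    Real.rpow_le_rpow_of_exponent_le hR (neg_le_neg (min_le_left _ _))
  have hp : 0 ≤ R ^ (-(min σ ((N : ℝ) - 2))) := by positivity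
  have := mul_le_mul_of_nonneg_left hle
    (by positivity : 0 ≤ (2 : ℝ) ^ (2 + σ) * (∫ w, F w))
  nlinarith
end
end

section
/- Let m0 > 2 be a real number. Then there exists a constant C > 0 such that for all real numbers a and b: (i) if 2 < m0 < 3 then | |a+b|^{m0−2}(a+b) − |a|^{m0−2}a − (m0−1)|a|^{m0−2}b | ≤ C |b|^{m0−1}; (ii) if m0 ≥ 3 then | |a+b|^{m0−2}(a+b) − |a|^{m0−2}a − (m0−1)|a|^{m0−2}b | ≤ C ( |a|^{m0−3} b² + |b|^{m0−1} ). -/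
noncomputable section

lemma aux_deriv (p : ℝ) (hp : 0 < p) (x : ℝ) :
    HasDerivAt (fun t : ℝ => |t| ^ p * t) ((p + 1) * |x| ^ p) x := by
  rcases eq_or_ne x 0 with rfl | hx
  · rw [hasDerivAt_iff_tendsto_slope]
    have h1 : Filter.Tendsto (fun t : ℝ => |t| ^ p) (nhdsWithin 0 {0}ᶜ)
        (nhds ((p + 1) * |(0:ℝ)| ^ p)) := by
      have hc : Continuous (fun t : ℝ => |t| ^ p) :=
        continuous_abs.rpow_const (fun _ => Or.inr hp.le)
      have := hc.tendsto 0
      simp only [abs_zero, Real.zero_rpow hp.ne', mul_zero] at this ⊢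
      exact this.mono_left nhdsWithin_le_nhds
    refine h1.congr' ?_
    filter_upwards [self_mem_nhdsWithin] with t ht
    have ht' : t ≠ 0 := ht
    simp [slope_def_field, ht']
  · have h := ((hasDerivAt_abs hx).rpow_const (p := p) (Or.inl (abs_ne_zero.2 hx))).mul
      (hasDerivAt_id x)
    refine h.congr_deriv ?_
    have e : |x| ^ p = |x| ^ (p - 1) * |x| := by
      rw [← Real.rpow_add_one (abs_ne_zero.2 hx)]; ring_nf
    have s : ((SignType.sign x : SignType) : ℝ) * x = |x| := sign_mul_self x
    simp only [id]
    rw [e, ← s]; ring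

lemma aux_mvt (p : ℝ) (hp : 0 < p) (a b K : ℝ)
    (hK : ∀ t : ℝ, |t| ≤ |b| → abs (|a + t| ^ p - |a| ^ p) ≤ K) :
    abs (|a + b| ^ p * (a + b) - |a| ^ p * a - (p + 1) * |a| ^ p * b) ≤ (p + 1) * K * |b| := by
  have hd : ∀ t ∈ Set.Icc (-|b|) |b|, HasDerivWithinAt
      (fun t : ℝ => |a + t| ^ p * (a + t) - (p + 1) * |a| ^ p * t)
      ((p + 1) * |a + t| ^ p - (p + 1) * |a| ^ p) (Set.Icc (-|b|) |b|) t := by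
    intro t _
    have h1 := (aux_deriv p hp (a + t)).comp_const_add a t
    have h2 := (hasDerivAt_id t).const_mul ((p + 1) * |a| ^ p)
    have := (h1.sub h2).hasDerivWithinAt (s := Set.Icc (-|b|) |b|)
    exact this.congr_deriv (by simp)
  have := Convex.norm_image_sub_le_of_norm_hasDerivWithin_le (C := (p + 1) * K)
    (x := 0) (y := b) hd ?_ (convex_Icc _ _) (by simp) (by simp [neg_abs_le, le_abs_self])
  · simp only [Real.norm_eq_abs, sub_zero, add_zero, mul_zero] at this
    convert this using 2; ring
  · intro t ht
    rw [← mul_sub, norm_mul, Real.norm_eq_abs, Real.norm_eq_abs, abs_of_pos (by linarith : 0 < p + 1)]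
    exact mul_le_mul_of_nonneg_left (hK t (abs_le.2 ht)) (by linarith)

lemma aux_small (p : ℝ) (hp : 0 < p) (hp1 : p ≤ 1) (x y : ℝ) :
    |x| ^ p - |y| ^ p ≤ |x - y| ^ p := by
  have h1 : |x| ^ p ≤ (|x - y| + |y|) ^ p := by
    refine Real.rpow_le_rpow (abs_nonneg _) ?_ hp.le
    simpa using abs_add_le (x - y) y
  have h2 := Real.rpow_add_le_add_rpow (abs_nonneg (x - y)) (abs_nonneg y) hp.le hp1
  linarith

lemma aux_big (p : ℝ) (hp : 1 ≤ p) (x y M : ℝ) (hx : |x| ≤ M) (hy : |y| ≤ M) :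
    abs (|x| ^ p - |y| ^ p) ≤ p * M ^ (p - 1) * |x - y| := by
  have hM : 0 ≤ M := (abs_nonneg x).trans hx
  have := Convex.norm_image_sub_le_of_norm_hasDerivWithin_le (C := p * M ^ (p - 1))
    (f := fun t : ℝ => t ^ p) (f' := fun t => p * t ^ (p - 1)) (s := Set.Icc 0 M)
    (x := |y|) (y := |x|)
    (fun t _ => (Real.hasDerivAt_rpow_const (Or.inr hp)).hasDerivWithinAt) ?_
    (convex_Icc _ _) ⟨abs_nonneg _, hy⟩ ⟨abs_nonneg _, hx⟩
  · refine this.trans ?_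
    refine mul_le_mul_of_nonneg_left (abs_abs_sub_abs_le _ _) ?_
    have := Real.rpow_nonneg hM (p - 1)
    positivity
  · intro t ht
    have h0 := Real.rpow_nonneg ht.1 (p - 1)
    rw [Real.norm_eq_abs, abs_of_nonneg (by positivity)]
    exact mul_le_mul_of_nonneg_left (Real.rpow_le_rpow ht.1 ht.2 (by linarith)) (by linarith)

lemma aux_sum (q : ℝ) (hq : 0 ≤ q) (x y : ℝ) (hx : 0 ≤ x) (hy : 0 ≤ y) :
    (x + y) ^ q ≤ 2 ^ q * (x ^ q + y ^ q) := by
  have hxq := Real.rpow_nonneg hx q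
  have hyq := Real.rpow_nonneg hy q
  have h2 : (0:ℝ) ≤ 2 ^ q := by positivity
  rcases le_total x y with h | h
  · calc (x + y) ^ q ≤ (2 * y) ^ q := Real.rpow_le_rpow (by positivity) (by linarith) hq
      _ = 2 ^ q * y ^ q := Real.mul_rpow (by norm_num) hy
      _ ≤ _ := mul_le_mul_of_nonneg_left (by linarith) h2
  · calc (x + y) ^ q ≤ (2 * x) ^ q := Real.rpow_le_rpow (by positivity) (by linarith) hq
      _ = 2 ^ q * x ^ q := Real.mul_rpow (by norm_num) hx
      _ ≤ _ := mul_le_mul_of_nonneg_left (by linarith) h2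

/-- Lemma A.5: Taylor-type elementary inequality for the odd power function
`t ↦ |t|^{m₀−2} t`, for `m₀ > 2`. -/
theorem odd_power_taylor_estimate (m0 : ℝ) (hm0 : 2 < m0) :
    ∃ C : ℝ, 0 < C ∧
      ((2 < m0 ∧ m0 < 3) → ∀ a b : ℝ,
        abs (|a + b| ^ (m0 - 2) * (a + b) - |a| ^ (m0 - 2) * a
            - (m0 - 1) * |a| ^ (m0 - 2) * b) ≤
          C * |b| ^ (m0 - 1)) ∧
      (3 ≤ m0 → ∀ a b : ℝ, (m0 = 3 → a ≠ 0) →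
        abs (|a + b| ^ (m0 - 2) * (a + b) - |a| ^ (m0 - 2) * a
            - (m0 - 1) * |a| ^ (m0 - 2) * b) ≤
          C * (|a| ^ (m0 - 3) * b ^ 2 + |b| ^ (m0 - 1))) := by
  obtain ⟨p, rfl⟩ : ∃ p, m0 = p + 2 := ⟨m0 - 2, by ring⟩
  have hp : 0 < p := by linarith
  have e1 : p + 2 - 2 = p := by ring
  have e2 : p + 2 - 1 = p + 1 := by ring
  have e3 : p + 2 - 3 = p - 1 := by ring
  rw [e1, e2, e3]
  rcases lt_or_ge p 1 with h1 | h1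
  · refine ⟨p + 1, by linarith, fun _ a b => ?_, fun h => by linarith⟩
    have hb : |b| ^ (p + 1) = |b| ^ p * |b| := Real.rpow_add_one' (abs_nonneg b) (by linarith)
    rw [hb, ← mul_assoc]
    refine aux_mvt p hp a b _ fun t ht => ?_
    have hm : |t| ^ p ≤ |b| ^ p := Real.rpow_le_rpow (abs_nonneg _) ht hp.le
    have u1 := aux_small p hp h1.le (a + t) a
    have u2 := aux_small p hp h1.le a (a + t)
    have v1 : a + t - a = t := by ring
    have v2 : a - (a + t) = -t := by ring
    rw [v1] at u1
    rw [v2, abs_neg] at u2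
    rw [abs_le]; constructor <;> linarith
  · refine ⟨(p + 1) * (p * 2 ^ (p - 1)), by positivity, fun h => by linarith [h.2],
      fun _ a b _ => ?_⟩
    have hb : |b| ^ (p + 1) = |b| ^ (p - 1) * b ^ 2 := by
      rw [← sq_abs b, ← Real.rpow_natCast |b| 2, ← Real.rpow_add' (abs_nonneg b)]
      · congr 1; push_cast; ring
      · push_cast; linarith
    have hM : (0:ℝ) ≤ (|a| + |b|) ^ (p - 1) := by positivity
    refine (aux_mvt p hp a b (p * (|a| + |b|) ^ (p - 1) * |b|) fun t ht => ?_).trans ?_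
    · have := aux_big p h1 (a + t) a (|a| + |b|) ((abs_add_le a t).trans (by linarith))
        (by linarith [abs_nonneg b])
      rw [add_sub_cancel_left] at this
      exact this.trans (mul_le_mul_of_nonneg_left ht (by positivity))
    · have hs := aux_sum (p - 1) (by linarith) |a| |b| (abs_nonneg a) (abs_nonneg b)
      rw [hb, ← add_mul]
      calc (p + 1) * (p * (|a| + |b|) ^ (p - 1) * |b|) * |b|
          = ((p + 1) * p * b ^ 2) * (|a| + |b|) ^ (p - 1) := by rw [← sq_abs b]; ring
        _ ≤ ((p + 1) * p * b ^ 2) * (2 ^ (p - 1) * (|a| ^ (p - 1) + |b| ^ (p - 1))) :=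
            mul_le_mul_of_nonneg_left hs (by positivity)
        _ = _ := by ring
end
end

section
/- Let k ≥ 1 be an integer and let t_1, …, t_k be nonnegative real numbers. Then for all real numbers τ, α, β with 0 < τ ≤ α and β > 1: ( Σ_{i=1}^k t_i^α )^β ≤ ( Σ_{i=1}^k t_i^τ )^{β−1} · Σ_{i=1}^k t_i^{αβ−(β−1)τ}. -/
noncomputable section

/-- Estimate (A.4)/(tau1a): discrete Hölder-type inequality for real powers of
nonnegative numbers. -/
theorem discrete_holder_power_estimate
    (k : ℕ) (hk : 1 ≤ k) (t : ℕ → ℝ) (ht : ∀ i, 0 ≤ t i)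
    (τ α β : ℝ) (hτ : 0 < τ) (hτα : τ ≤ α) (hβ : 1 < β) :
    (∑ i ∈ Finset.range k, t i ^ α) ^ β ≤
      (∑ i ∈ Finset.range k, t i ^ τ) ^ (β - 1) *
        ∑ i ∈ Finset.range k, t i ^ (α * β - (β - 1) * τ) := by
  have h := Real.inner_le_weight_mul_Lp_of_nonneg (Finset.range k) hβ.le
    (fun i => t i ^ τ) (fun i => t i ^ (α - τ))
    (fun i => Real.rpow_nonneg (ht i) _) (fun i => Real.rpow_nonneg (ht i) _)
  have hβ0 : 0 < β := by linarith
  have e1 : ∀ i, t i ^ τ * t i ^ (α - τ) = t i ^ α := fun i => by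
    rw [← Real.rpow_add_of_nonneg (ht i) hτ.le (by linarith)]
    congr 1; ring
  have e2 : ∀ i, t i ^ τ * (t i ^ (α - τ)) ^ β = t i ^ (α * β - (β - 1) * τ) := fun i => by
    rw [← Real.rpow_mul (ht i), ← Real.rpow_add_of_nonneg (ht i) hτ.le
      (mul_nonneg (by linarith) hβ0.le)]
    congr 1; ring
  simp only [e1, e2] at h
  have n : ∀ p : ℝ, 0 ≤ ∑ i ∈ Finset.range k, t i ^ p := fun p =>
    Finset.sum_nonneg fun i _ => Real.rpow_nonneg (ht i) _
  have h2 := Real.rpow_le_rpow (n α) h hβ0.le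
  rw [Real.mul_rpow (Real.rpow_nonneg (n _) _) (Real.rpow_nonneg (n _) _),
    ← Real.rpow_mul (n _), ← Real.rpow_mul (n _), inv_mul_cancel₀ hβ0.ne', Real.rpow_one,
    sub_mul, inv_mul_cancel₀ hβ0.ne', one_mul] at h2
  exact h2
end
end
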